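/- Let k be a field, q ∈ k^* not a root of unity, and a ∈ k[h^{±1}] with a ≠ 0. In A = k[h^{±1}](σ_q, a) with σ_q(h) = qh, the multiplicative set Σ generated by x consists of regular elements and satisfies the Ore condition, and the Ore localization A·Σ^{-1} is isomorphic as a k-algebra to the quantum torus T_q. -/

import Mathlib

open LaurentPolynomial

/-- The defining relations of the degree-one generalized Weyl algebra `k[h^{±1}](σ, a)`:
the generators `Sum.inl p` (for `p` a Laurent polynomial) give a copy of `k[h^{±1}]`,
and the generators `x = Sum.inr 0` and `y = Sum.inr 1` satisfy
`y x = a`, `x y = σ a`, `x r = σ(r) x` and `y r = σ⁻¹(r) y` for all `r ∈ k[h^{±1}]`. -/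
inductive GWARel (k : Type*) [CommRing k] (σ : LaurentPolynomial k ≃ₐ[k] LaurentPolynomial k)
    (a : LaurentPolynomial k) :
    FreeAlgebra k (LaurentPolynomial k ⊕ Fin 2) →
      FreeAlgebra k (LaurentPolynomial k ⊕ Fin 2) → Prop
  | add (r s : LaurentPolynomial k) :
      GWARel k σ a (FreeAlgebra.ι k (Sum.inl (r + s)))
        (FreeAlgebra.ι k (Sum.inl r) + FreeAlgebra.ι k (Sum.inl s))
  | mul (r s : LaurentPolynomial k) :
      GWARel k σ a (FreeAlgebra.ι k (Sum.inl (r * s)))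
        (FreeAlgebra.ι k (Sum.inl r) * FreeAlgebra.ι k (Sum.inl s))
  | smul (c : k) (r : LaurentPolynomial k) :
      GWARel k σ a (FreeAlgebra.ι k (Sum.inl (c • r))) (c • FreeAlgebra.ι k (Sum.inl r))
  | one : GWARel k σ a (FreeAlgebra.ι k (Sum.inl 1)) 1
  | xr (r : LaurentPolynomial k) :
      GWARel k σ a (FreeAlgebra.ι k (Sum.inr 0) * FreeAlgebra.ι k (Sum.inl r))
        (FreeAlgebra.ι k (Sum.inl (σ r)) * FreeAlgebra.ι k (Sum.inr 0))
  | yr (r : LaurentPolynomial k) :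
      GWARel k σ a (FreeAlgebra.ι k (Sum.inr 1) * FreeAlgebra.ι k (Sum.inl r))
        (FreeAlgebra.ι k (Sum.inl (σ.symm r)) * FreeAlgebra.ι k (Sum.inr 1))
  | yx : GWARel k σ a (FreeAlgebra.ι k (Sum.inr 1) * FreeAlgebra.ι k (Sum.inr 0))
        (FreeAlgebra.ι k (Sum.inl a))
  | xy : GWARel k σ a (FreeAlgebra.ι k (Sum.inr 0) * FreeAlgebra.ι k (Sum.inr 1))
        (FreeAlgebra.ι k (Sum.inl (σ a)))

/-- The degree-one generalized Weyl algebra `k[h^{±1}](σ, a)`, presented as the quotient of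
the free algebra on `k[h^{±1}] ⊕ {x, y}` by the generalized Weyl relations. -/
abbrev GWA (k : Type*) [CommRing k] (σ : LaurentPolynomial k ≃ₐ[k] LaurentPolynomial k)
    (a : LaurentPolynomial k) :=
  RingQuot (GWARel k σ a)

namespace GWA

variable {k : Type*} [CommRing k] (σ : LaurentPolynomial k ≃ₐ[k] LaurentPolynomial k)
  (a : LaurentPolynomial k)

/-- The copy of the Laurent polynomial `p` inside the generalized Weyl algebra. -/
noncomputable def r (p : LaurentPolynomial k) : GWA k σ a :=
  RingQuot.mkAlgHom k (GWARel k σ a) (FreeAlgebra.ι k (Sum.inl p))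

/-- The element `h` of the generalized Weyl algebra. -/
noncomputable def H : GWA k σ a := r σ a (T 1)

/-- The element `h⁻¹` of the generalized Weyl algebra. -/
noncomputable def Hinv : GWA k σ a := r σ a (T (-1))

/-- The generator `x` of the generalized Weyl algebra. -/
noncomputable def x : GWA k σ a :=
  RingQuot.mkAlgHom k (GWARel k σ a) (FreeAlgebra.ι k (Sum.inr 0))

/-- The generator `y` of the generalized Weyl algebra. -/
noncomputable def y : GWA k σ a :=
  RingQuot.mkAlgHom k (GWARel k σ a) (FreeAlgebra.ι k (Sum.inr 1))

end GWA

/-- An element `a ∈ k[h^{±1}]` is a monomial if `a = c·hⁱ` for some `c ∈ k`, `i ∈ ℤ`. -/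
def LaurentPolynomial.IsMonomial {k : Type*} [CommRing k] (a : LaurentPolynomial k) : Prop :=
  ∃ (c : k) (i : ℤ), a = C c * T i

/-- The defining relations of the quantum torus: generators `X = 0`, `X⁻¹ = 1`, `Y = 2`,
`Y⁻¹ = 3`, with `X X⁻¹ = X⁻¹ X = Y Y⁻¹ = Y⁻¹ Y = 1` and `X Y = q Y X`. -/
inductive QuantumTorusRel (k : Type*) [CommRing k] (q : k) :
    FreeAlgebra k (Fin 4) → FreeAlgebra k (Fin 4) → Prop
  | XXi : QuantumTorusRel k q (FreeAlgebra.ι k 0 * FreeAlgebra.ι k 1) 1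
  | XiX : QuantumTorusRel k q (FreeAlgebra.ι k 1 * FreeAlgebra.ι k 0) 1
  | YYi : QuantumTorusRel k q (FreeAlgebra.ι k 2 * FreeAlgebra.ι k 3) 1
  | YiY : QuantumTorusRel k q (FreeAlgebra.ι k 3 * FreeAlgebra.ι k 2) 1
  | comm : QuantumTorusRel k q (FreeAlgebra.ι k 0 * FreeAlgebra.ι k 2)
      (q • (FreeAlgebra.ι k 2 * FreeAlgebra.ι k 0))

/-- The quantum torus `T_q`. -/
abbrev QuantumTorus (k : Type*) [CommRing k] (q : k) := RingQuot (QuantumTorusRel k q)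

/-- Two algebra maps out of the Laurent polynomials that are intertwined by `c` at the variable
are intertwined by `c` everywhere. -/
theorem LaurentPolynomial.semiconjBy_algHom {k B : Type*} [CommRing k] [Ring B] [Algebra k B]
    (φ ψ : LaurentPolynomial k →ₐ[k] B) (c : B) (h : SemiconjBy c (φ (T 1)) (ψ (T 1)))
    (p : LaurentPolynomial k) : SemiconjBy c (φ p) (ψ p) := by
  have hT (χ : LaurentPolynomial k →ₐ[k] B) (m n : ℤ) : χ (T m) * χ (T n) = χ (T (m + n)) := by
    rw [← map_mul, ← T_add]
  have h1 : SemiconjBy c (φ (T (-1))) (ψ (T (-1))) := by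
    have key : ψ (T (-1)) * (c * φ (T 1)) * φ (T (-1)) =
        ψ (T (-1)) * (ψ (T 1) * c) * φ (T (-1)) := by rw [h.eq]
    simp only [mul_assoc, hT] at key
    simp only [← mul_assoc, hT] at key
    simpa [SemiconjBy] using key.symm
  have hC (r : k) : SemiconjBy c (φ (C r)) (ψ (C r)) := by
    have e : (C r : LaurentPolynomial k) = algebraMap k _ r := rfl
    rw [e, φ.commutes, ψ.commutes]
    exact (Algebra.commutes r c).symm
  induction p using LaurentPolynomial.induction_on with
  | h_C r => exact hC r
  | h_add hp hq => simpa using hp.add_right hq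
  | h_C_mul_T n r hn =>
    rw [T_add, ← mul_assoc, map_mul φ, map_mul ψ]
    exact hn.mul_right h
  | h_C_mul_T_Z n r hn =>
    rw [sub_eq_add_neg, T_add, ← mul_assoc, map_mul φ, map_mul ψ]
    exact hn.mul_right h1

section FreeAlgebraQuotient

variable {k ι : Type*} [CommRing k] {rel : FreeAlgebra k ι → FreeAlgebra k ι → Prop}
  {S : Submodule k (RingQuot rel)}

theorem RingQuot.mem_of_mul_left_closed (h1 : 1 ∈ S)
    (h : ∀ i, ∀ b ∈ S, RingQuot.mkAlgHom k rel (FreeAlgebra.ι k i) * b ∈ S)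
    (b : RingQuot rel) : b ∈ S := by
  obtain ⟨w, rfl⟩ := RingQuot.mkAlgHom_surjective k rel b
  suffices H : ∀ c ∈ S, RingQuot.mkAlgHom k rel w * c ∈ S by simpa using H 1 h1
  induction w using FreeAlgebra.induction with
  | grade0 r =>
    intro c hc
    rw [AlgHom.commutes, ← Algebra.smul_def]
    exact S.smul_mem r hc
  | grade1 i => exact h i
  | mul u v hu hv =>
    intro c hc
    rw [map_mul, mul_assoc]
    exact hu _ (hv _ hc)
  | add u v hu hv =>
    intro c hc
    rw [map_add, add_mul]
    exact S.add_mem (hu _ hc) (hv _ hc)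

theorem RingQuot.mem_of_mul_right_closed (h1 : 1 ∈ S)
    (h : ∀ i, ∀ b ∈ S, b * RingQuot.mkAlgHom k rel (FreeAlgebra.ι k i) ∈ S)
    (b : RingQuot rel) : b ∈ S := by
  obtain ⟨w, rfl⟩ := RingQuot.mkAlgHom_surjective k rel b
  suffices H : ∀ c ∈ S, c * RingQuot.mkAlgHom k rel w ∈ S by simpa using H 1 h1
  induction w using FreeAlgebra.induction with
  | grade0 r =>
    intro c hc
    rw [AlgHom.commutes, ← Algebra.commutes, ← Algebra.smul_def]
    exact S.smul_mem r hc
  | grade1 i => exact h i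
  | mul u v hu hv =>
    intro c hc
    rw [map_mul, ← mul_assoc]
    exact hv _ (hu _ hc)
  | add u v hu hv =>
    intro c hc
    rw [map_add, mul_add]
    exact S.add_mem (hu _ hc) (hv _ hc)

end FreeAlgebraQuotient

namespace GWA

variable {k : Type*} [CommRing k] (σ : LaurentPolynomial k ≃ₐ[k] LaurentPolynomial k)
  (a : LaurentPolynomial k)

/-- The structure map `k[h^{±1}] → k[h^{±1}](σ, a)` as an algebra map. -/
noncomputable def rHom : LaurentPolynomial k →ₐ[k] GWA k σ a :=
  AlgHom.ofLinearMap
    { toFun := r σ a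
      map_add' := fun p s => by
        simpa [r] using RingQuot.mkAlgHom_rel k (GWARel.add (σ := σ) (a := a) p s)
      map_smul' := fun c p => by
        simpa [r] using RingQuot.mkAlgHom_rel k (GWARel.smul (σ := σ) (a := a) c p) }
    (by simpa [r] using RingQuot.mkAlgHom_rel k (GWARel.one (σ := σ) (a := a)))
    (fun p s => by
      simpa [r] using RingQuot.mkAlgHom_rel k (GWARel.mul (σ := σ) (a := a) p s))

theorem x_mul_rHom (p : LaurentPolynomial k) :
    x σ a * rHom σ a p = rHom σ a (σ p) * x σ a := by
  have := RingQuot.mkAlgHom_rel k (GWARel.xr (σ := σ) (a := a) p)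
  rwa [map_mul, map_mul] at this

theorem y_mul_rHom (p : LaurentPolynomial k) :
    y σ a * rHom σ a p = rHom σ a (σ.symm p) * y σ a := by
  have := RingQuot.mkAlgHom_rel k (GWARel.yr (σ := σ) (a := a) p)
  rwa [map_mul, map_mul] at this

theorem y_mul_x : y σ a * x σ a = rHom σ a a := by
  have := RingQuot.mkAlgHom_rel k (GWARel.yx (σ := σ) (a := a))
  rwa [map_mul] at this

theorem x_mul_y : x σ a * y σ a = rHom σ a (σ a) := by
  have := RingQuot.mkAlgHom_rel k (GWARel.xy (σ := σ) (a := a))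
  rwa [map_mul] at this

/-- The graded pieces `xⁱ` for `i ≥ 0` and `y⁻ⁱ` for `i ≤ 0`. -/
noncomputable def z : ℤ → GWA k σ a
  | Int.ofNat n => x σ a ^ n
  | Int.negSucc n => y σ a ^ (n + 1)

theorem exists_x_mul_z (i : ℤ) : ∃ c, x σ a * z σ a i = rHom σ a c * z σ a (i + 1) := by
  obtain n | n := i
  · exact ⟨1, by rw [map_one, one_mul]; exact (pow_succ' _ _).symm⟩
  · refine ⟨σ a, ?_⟩
    obtain _ | n := n
    · simp [z, x_mul_y]
    · have e : Int.negSucc (n + 1) + 1 = Int.negSucc n := by omega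
      rw [e]
      simp only [z]
      rw [pow_succ' _ (n + 1), ← mul_assoc, x_mul_y]

theorem exists_y_mul_z (i : ℤ) : ∃ c, y σ a * z σ a i = rHom σ a c * z σ a (i - 1) := by
  obtain n | n := i
  · obtain _ | n := n
    · exact ⟨1, by
        rw [show Int.ofNat 0 - 1 = Int.negSucc 0 from rfl]
        simp [z]⟩
    · refine ⟨a, ?_⟩
      have e : Int.ofNat (n + 1) - 1 = Int.ofNat n := by simp
      rw [e]
      simp only [z]
      rw [pow_succ' _ n, ← mul_assoc, y_mul_x]
  · exact ⟨1, by rw [map_one, one_mul]; exact (pow_succ' _ _).symm⟩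

/-- The map `(pᵢ) ↦ ∑ pᵢ zᵢ` from finitely supported families of Laurent polynomials. -/
noncomputable def sumZ : (ℤ →₀ LaurentPolynomial k) →ₗ[k] GWA k σ a :=
  Finsupp.lsum k fun i => (LinearMap.mulRight k (z σ a i)).comp (rHom σ a).toLinearMap

theorem sumZ_single (i : ℤ) (p : LaurentPolynomial k) :
    sumZ σ a (Finsupp.single i p) = rHom σ a p * z σ a i := by
  simp [sumZ]

theorem rHom_mul_z_mem_range (i : ℤ) (p : LaurentPolynomial k) :
    rHom σ a p * z σ a i ∈ LinearMap.range (sumZ σ a) :=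
  ⟨_, sumZ_single σ a i p⟩

theorem sumZ_surjective : Function.Surjective (sumZ σ a) := by
  refine RingQuot.mem_of_mul_left_closed (S := LinearMap.range (sumZ σ a)) ?_ ?_
  · simpa [z] using rHom_mul_z_mem_range σ a (Int.ofNat 0) 1
  · rintro j _ ⟨v, rfl⟩
    induction v using Finsupp.induction_linear with
    | zero => simp
    | add u v hu hv =>
      rw [map_add, mul_add]
      exact Submodule.add_mem _ hu hv
    | single i p =>
      rw [sumZ_single]
      obtain s | j := j
      · have e : RingQuot.mkAlgHom k (GWARel k σ a) (FreeAlgebra.ι k (Sum.inl s)) =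
          rHom σ a s := rfl
        rw [e, ← mul_assoc, ← map_mul]
        exact rHom_mul_z_mem_range σ a _ _
      · fin_cases j
        · obtain ⟨c, hc⟩ := exists_x_mul_z σ a i
          change x σ a * _ ∈ _
          rw [← mul_assoc, x_mul_rHom, mul_assoc, hc, ← mul_assoc, ← map_mul]
          exact rHom_mul_z_mem_range σ a _ _
        · obtain ⟨c, hc⟩ := exists_y_mul_z σ a i
          change y σ a * _ ∈ _
          rw [← mul_assoc, y_mul_rHom, mul_assoc, hc, ← mul_assoc, ← map_mul]
          exact rHom_mul_z_mem_range σ a _ _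

variable {σ}

/-- A representation of `k[h^{±1}]` in which a unit `u` acts as `σ` extends to the generalized Weyl
algebra, with `x ↦ u` and `y ↦ a u⁻¹`. -/
theorem exists_algHom_of_semiconjBy {B : Type*} [Ring B] [Algebra k B]
    (L : LaurentPolynomial k →ₐ[k] B) (u : Bˣ) (h : ∀ p, SemiconjBy (u : B) (L p) (L (σ p))) :
    ∃ f : GWA k σ a →ₐ[k] B, (∀ p, f (rHom σ a p) = L p) ∧ f (x σ a) = u ∧
      f (y σ a) = L a * (↑u⁻¹ : B) := by
  have h' (p) : (↑u⁻¹ : B) * L p = L (σ.symm p) * (↑u⁻¹ : B) := by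
    have := (h (σ.symm p)).units_inv_symm_left
    simpa using this.eq
  let g : FreeAlgebra k (LaurentPolynomial k ⊕ Fin 2) →ₐ[k] B :=
    FreeAlgebra.lift k (Sum.elim L ![(u : B), L a * (↑u⁻¹ : B)])
  have hg : ∀ ⦃v w⦄, GWARel k σ a v w → g v = g w := by
    intro v w hvw
    cases hvw with
    | add r s => simp [g]
    | mul r s => simp [g]
    | smul c r => simp [g]
    | one => simp [g]
    | xr r => simpa [g] using (h r).eq
    | yr r =>
      simp only [g, map_mul, FreeAlgebra.lift_ι_apply, Sum.elim_inl, Sum.elim_inr,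
        Matrix.cons_val_one, Matrix.cons_val_fin_one]
      rw [mul_assoc, h', ← mul_assoc, ← mul_assoc, ← map_mul, ← map_mul, mul_comm]
    | yx => simp [g]
    | xy => simp [g, ← mul_assoc, (h a).eq]
  refine ⟨RingQuot.liftAlgHom k ⟨g, hg⟩, fun p => ?_, ?_, ?_⟩
  · exact (RingQuot.liftAlgHom_mkAlgHom_apply k g hg _).trans (by simp [g])
  · exact (RingQuot.liftAlgHom_mkAlgHom_apply k g hg _).trans (by simp [g])
  · exact (RingQuot.liftAlgHom_mkAlgHom_apply k g hg _).trans (by simp [g])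

end GWA

namespace QuantumTorus

variable {k : Type*} [CommRing k] (q : k)

/-- The generator `X` of the quantum torus as a unit. -/
noncomputable def X : (QuantumTorus k q)ˣ where
  val := RingQuot.mkAlgHom k (QuantumTorusRel k q) (FreeAlgebra.ι k 0)
  inv := RingQuot.mkAlgHom k (QuantumTorusRel k q) (FreeAlgebra.ι k 1)
  val_inv := by simpa using RingQuot.mkAlgHom_rel k (QuantumTorusRel.XXi (q := q))
  inv_val := by simpa using RingQuot.mkAlgHom_rel k (QuantumTorusRel.XiX (q := q))

/-- The generator `Y` of the quantum torus as a unit. -/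
noncomputable def Y : (QuantumTorus k q)ˣ where
  val := RingQuot.mkAlgHom k (QuantumTorusRel k q) (FreeAlgebra.ι k 2)
  inv := RingQuot.mkAlgHom k (QuantumTorusRel k q) (FreeAlgebra.ι k 3)
  val_inv := by simpa using RingQuot.mkAlgHom_rel k (QuantumTorusRel.YYi (q := q))
  inv_val := by simpa using RingQuot.mkAlgHom_rel k (QuantumTorusRel.YiY (q := q))

theorem X_mul_Y : (X q : QuantumTorus k q) * Y q = q • ((Y q : QuantumTorus k q) * X q) := by
  have := RingQuot.mkAlgHom_rel k (QuantumTorusRel.comm (q := q))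
  rwa [map_smul, map_mul, map_mul] at this

/-- The map `k[h^{±1}] → T_q` sending `h` to `Y`. -/
noncomputable def evalY : LaurentPolynomial k →ₐ[k] QuantumTorus k q :=
  AddMonoidAlgebra.lift k (QuantumTorus k q) ℤ
    ((Units.coeHom (QuantumTorus k q)).comp (zpowersHom (QuantumTorus k q)ˣ (Y q)))

theorem evalY_T (n : ℤ) : evalY q (T n) = ((Y q ^ n : (QuantumTorus k q)ˣ) : QuantumTorus k q) := by
  rw [evalY, T, AddMonoidAlgebra.lift_single, one_smul]
  rfl

theorem semiconjBy_X {σ : LaurentPolynomial k ≃ₐ[k] LaurentPolynomial k}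
    (hσ : σ (T 1) = C q * T 1) (p : LaurentPolynomial k) :
    SemiconjBy (X q : QuantumTorus k q) (evalY q p) (evalY q (σ p)) := by
  have h : SemiconjBy (X q : QuantumTorus k q) (evalY q (T 1)) (evalY q (σ (T 1))) := by
    rw [SemiconjBy, hσ, ← LaurentPolynomial.smul_eq_C_mul, map_smul, evalY_T, zpow_one, X_mul_Y,
      smul_mul_assoc]
  exact LaurentPolynomial.semiconjBy_algHom (evalY q) ((evalY q).comp σ.toAlgHom) _ h p

variable {q}

theorem exists_rep {σ : LaurentPolynomial k ≃ₐ[k] LaurentPolynomial k}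
    (hσ : σ (T 1) = C q * T 1) :
    ∃ ρ : QuantumTorus k q →ₐ[k] Module.End k (ℤ → LaurentPolynomial k),
      (∀ p m i, ρ (evalY q p) m i = p * m i) ∧
      (∀ m i, ρ (X q) m i = σ (m (i - 1))) ∧
      (∀ m i, ρ (↑(X q)⁻¹) m i = σ.symm (m (i + 1))) := by
  let E : Module.End k (ℤ → LaurentPolynomial k) :=
    LinearMap.pi fun i => σ.toLinearMap.comp (LinearMap.proj (i - 1))
  let E' : Module.End k (ℤ → LaurentPolynomial k) :=
    LinearMap.pi fun i => σ.symm.toLinearMap.comp (LinearMap.proj (i + 1))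
  let M : LaurentPolynomial k →ₐ[k] Module.End k (ℤ → LaurentPolynomial k) :=
    Algebra.lsmul k k (ℤ → LaurentPolynomial k)
  let g : FreeAlgebra k (Fin 4) →ₐ[k] Module.End k (ℤ → LaurentPolynomial k) :=
    FreeAlgebra.lift k ![E, E', M (T 1), M (T (-1))]
  have hT (m n : ℤ) : M (T m) * M (T n) = M (T (m + n)) := by rw [← map_mul, ← T_add]
  have hg : ∀ ⦃v w⦄, QuantumTorusRel k q v w → g v = g w := by
    intro v w hvw
    cases hvw with
    | XXi => ext1 m; funext i; simp [g, E, E']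
    | XiX => ext1 m; funext i; simp [g, E, E']
    | YYi => simp [g, hT]
    | YiY => simp [g, hT]
    | comm =>
      ext1 m
      funext i
      simp [g, E, M, hσ, LaurentPolynomial.smul_eq_C_mul, mul_left_comm]
  let ρ := RingQuot.liftAlgHom k ⟨g, hg⟩
  have hρ (j) : ρ (RingQuot.mkAlgHom k (QuantumTorusRel k q) (FreeAlgebra.ι k j)) =
      ![E, E', M (T 1), M (T (-1))] j :=
    (RingQuot.liftAlgHom_mkAlgHom_apply k g hg _).trans (by simp [g])
  refine ⟨ρ, fun p m i => ?_, fun m i => ?_, fun m i => ?_⟩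
  · have key := LaurentPolynomial.semiconjBy_algHom (ρ.comp (evalY q)) M 1 ?_ p
    · have key' : ρ (evalY q p) = M p := by simpa [SemiconjBy] using key
      rw [key']
      simp [M]
    · rw [AlgHom.comp_apply, evalY_T, zpow_one, SemiconjBy, one_mul, mul_one]
      exact hρ 2
  · exact congrFun (LinearMap.congr_fun (hρ 0) m) i
  · exact congrFun (LinearMap.congr_fun (hρ 1) m) i

/-- If `x` maps to `X`, every element of the quantum torus is a right fraction. -/
theorem exists_mul_X_pow_eq {σ : LaurentPolynomial k ≃ₐ[k] LaurentPolynomial k}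
    (hσ : σ (T 1) = C q * T 1) {a : LaurentPolynomial k} (f : GWA k σ a →ₐ[k] QuantumTorus k q)
    (hfr : ∀ p, f (GWA.rHom σ a p) = evalY q p) (hfx : f (GWA.x σ a) = X q)
    (b : QuantumTorus k q) : ∃ (n : ℕ) (r : GWA k σ a), b * (X q : QuantumTorus k q) ^ n = f r := by
  let S : Submodule k (QuantumTorus k q) :=
    { carrier := {b | ∃ (n : ℕ) (r : GWA k σ a), b * (X q : QuantumTorus k q) ^ n = f r}
      zero_mem' := ⟨0, 0, by simp⟩
      add_mem' := by
        rintro b c ⟨m, r, hr⟩ ⟨n, s, hs⟩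
        refine ⟨m + n, r * GWA.x σ a ^ n + s * GWA.x σ a ^ m, ?_⟩
        rw [map_add, map_mul, map_mul, map_pow, map_pow, hfx, ← hr, ← hs, add_mul, mul_assoc,
          mul_assoc, ← pow_add, ← pow_add, add_comm n m]
      smul_mem' := by
        rintro c b ⟨m, r, hr⟩
        exact ⟨m, c • r, by rw [map_smul, ← hr, smul_mul_assoc]⟩ }
  have hcomm (n : ℕ) (p : LaurentPolynomial k) :
      ∃ p', evalY q p * (X q : QuantumTorus k q) ^ n = (X q : QuantumTorus k q) ^ n * evalY q p' := by
    induction n generalizing p with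
    | zero => exact ⟨p, by simp⟩
    | succ n ih =>
      obtain ⟨p', hp'⟩ := ih (σ.symm p)
      refine ⟨p', ?_⟩
      have := (semiconjBy_X q hσ (σ.symm p)).eq
      rw [AlgEquiv.apply_symm_apply] at this
      rw [pow_succ', ← mul_assoc, ← this, mul_assoc, hp', mul_assoc]
  have hS (p) (b) (hb : b ∈ S) : b * evalY q p ∈ S := by
    obtain ⟨n, r, hr⟩ := hb
    obtain ⟨p', hp'⟩ := hcomm n p
    exact ⟨n, r * GWA.rHom σ a p', by rw [mul_assoc, hp', ← mul_assoc, hr, map_mul, hfr]⟩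
  refine RingQuot.mem_of_mul_right_closed (S := S) ⟨0, 1, by simp⟩ (fun j b hb => ?_) b
  fin_cases j
  · obtain ⟨n, r, hr⟩ := hb
    change b * (X q : QuantumTorus k q) ∈ S
    refine ⟨n, r * GWA.x σ a, ?_⟩
    rw [mul_assoc, ← pow_succ', pow_succ, ← mul_assoc, hr, map_mul, hfx]
  · obtain ⟨n, r, hr⟩ := hb
    change b * (↑(X q)⁻¹ : QuantumTorus k q) ∈ S
    refine ⟨n + 1, r, ?_⟩
    rw [mul_assoc, pow_succ', Units.inv_mul_cancel_left, hr]
  · have h := hS (T 1) b hb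
    rwa [evalY_T, zpow_one] at h
  · have h := hS (T (-1)) b hb
    rwa [evalY_T, zpow_neg_one] at h

/-- The map from the generalized Weyl algebra to the quantum torus is injective when `a ≠ 0`. -/
theorem injective_of_apply_x {k : Type*} [Field k] {q : k}
    {σ : LaurentPolynomial k ≃ₐ[k] LaurentPolynomial k}
    (hσ : σ (T 1) = C q * T 1) {a : LaurentPolynomial k} (ha : a ≠ 0)
    (f : GWA k σ a →ₐ[k] QuantumTorus k q)
    (hfr : ∀ p, f (GWA.rHom σ a p) = evalY q p) (hfx : f (GWA.x σ a) = X q)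
    (hfy : f (GWA.y σ a) = evalY q a * (↑(X q)⁻¹ : QuantumTorus k q)) :
    Function.Injective f := by
  obtain ⟨ρ, hρr, hρx, hρx'⟩ := exists_rep hσ
  have hx (n : ℕ) : ρ (f (GWA.x σ a ^ n)) (Pi.single 0 1) = Pi.single (n : ℤ) 1 := by
    induction n with
    | zero => simp
    | succ n ih =>
      rw [pow_succ', map_mul, map_mul, Module.End.mul_apply, ih, hfx]
      funext i
      rw [hρx, Nat.cast_succ]
      by_cases h : i = n + 1
      · subst h; simp
      · rw [Pi.single_eq_of_ne h, Pi.single_eq_of_ne (by omega), map_zero]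
  have hy (n : ℕ) : ∃ b ≠ 0,
      ρ (f (GWA.y σ a ^ n)) (Pi.single 0 1) = Pi.single (-n : ℤ) b := by
    induction n with
    | zero => exact ⟨1, one_ne_zero, by simp⟩
    | succ n ih =>
      obtain ⟨b, hb, ih⟩ := ih
      refine ⟨a * σ.symm b, mul_ne_zero ha (by simpa using hb), ?_⟩
      rw [pow_succ', map_mul, map_mul, Module.End.mul_apply, ih, hfy, map_mul,
        Module.End.mul_apply]
      funext i
      rw [hρr, hρx']
      by_cases h : i = -(n + 1 : ℕ)
      · subst h; simp
      · rw [Pi.single_eq_of_ne h, Pi.single_eq_of_ne (by omega), map_zero, mul_zero]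
  have hz (i : ℤ) : ∃ b ≠ 0, ρ (f (GWA.z σ a i)) (Pi.single 0 1) = Pi.single i b := by
    obtain n | n := i
    · exact ⟨1, one_ne_zero, hx n⟩
    · exact hy (n + 1)
  choose b hb hz using hz
  rw [injective_iff_map_eq_zero]
  intro u hu
  obtain ⟨v, rfl⟩ := GWA.sumZ_surjective σ a u
  have hv (i : ℤ) : ρ (f (GWA.sumZ σ a v)) (Pi.single 0 1) i = v i * b i := by
    clear hu
    induction v using Finsupp.induction_linear with
    | zero => simp
    | add v w hv hw => simp [hv, hw, add_mul]
    | single j p =>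
      rw [GWA.sumZ_single, map_mul, map_mul, hfr, Module.End.mul_apply, hρr, hz]
      by_cases h : i = j
      · subst h; simp
      · rw [Pi.single_eq_of_ne h, Finsupp.single_eq_of_ne h, mul_zero, zero_mul]
  have : v = 0 := by
    ext1 i
    have := hv i
    rw [hu, map_zero] at this
    exact (mul_eq_zero.mp this.symm).resolve_right (hb i)
  rw [this, map_zero]

end QuantumTorus

/-- For `q ∈ k^*` not a root of unity and `a ≠ 0`, in
`A = k[h^{±1}](σ_q, a)` the multiplicative set `Σ` generated by `x` consists of regular
elements and satisfies the (right) Ore condition, and the Ore localization `A·Σ⁻¹` is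
isomorphic to the quantum torus `T_q`: there is an injective `k`-algebra map `f : A → T_q`
inverting `Σ` such that every element of `T_q` is a right fraction `f(r)·f(s)⁻¹`. -/
theorem quantum_gwa_localization_torus (k : Type*) [Field k] (q : k) (hq0 : q ≠ 0)
    (hq : ∀ n : ℕ, 0 < n → q ^ n ≠ 1)
    (σ : LaurentPolynomial k ≃ₐ[k] LaurentPolynomial k) (hσ : σ (T 1) = C q * T 1)
    (a : LaurentPolynomial k) (ha : a ≠ 0) :
    (∀ s ∈ Submonoid.powers (GWA.x σ a), IsRegular s) ∧
      (∀ (r : GWA k σ a), ∀ s ∈ Submonoid.powers (GWA.x σ a),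
        ∃ (r' : GWA k σ a), ∃ s' ∈ Submonoid.powers (GWA.x σ a), r * s' = s * r') ∧
      ∃ f : GWA k σ a →ₐ[k] QuantumTorus k q,
        Function.Injective f ∧
          (∀ s ∈ Submonoid.powers (GWA.x σ a), IsUnit (f s)) ∧
          ∀ b : QuantumTorus k q,
            ∃ (r : GWA k σ a), ∃ s ∈ Submonoid.powers (GWA.x σ a), b * f s = f r := by
  obtain ⟨f, hfr, hfx, hfy⟩ := GWA.exists_algHom_of_semiconjBy a (QuantumTorus.evalY q)
    (QuantumTorus.X q) (QuantumTorus.semiconjBy_X q hσ)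
  have hf := QuantumTorus.injective_of_apply_x hσ ha f hfr hfx hfy
  have hunit : ∀ s ∈ Submonoid.powers (GWA.x σ a), IsUnit (f s) := by
    rintro _ ⟨n, rfl⟩
    rw [map_pow, hfx]
    exact (QuantumTorus.X q).isUnit.pow n
  have hfrac (b : QuantumTorus k q) :
      ∃ (r : GWA k σ a), ∃ s ∈ Submonoid.powers (GWA.x σ a), b * f s = f r := by
    obtain ⟨n, r, hr⟩ := QuantumTorus.exists_mul_X_pow_eq hσ f hfr hfx b
    exact ⟨r, GWA.x σ a ^ n, ⟨n, rfl⟩, by rw [map_pow, hfx, hr]⟩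
  refine ⟨fun s hs => ⟨fun u v huv => hf ?_, fun u v huv => hf ?_⟩, fun r s hs => ?_,
    f, hf, hunit, hfrac⟩
  · have := congrArg f huv
    simp only [map_mul] at this
    exact (hunit s hs).mul_left_cancel this
  · have := congrArg f huv
    simp only [map_mul] at this
    exact (hunit s hs).mul_right_cancel this
  · obtain ⟨u, hu⟩ := hunit s hs
    obtain ⟨r', s', hs', h⟩ := hfrac ((↑u⁻¹ : QuantumTorus k q) * f r)
    refine ⟨r', s', hs', hf ?_⟩
    rw [map_mul, map_mul, ← h, ← hu, ← mul_assoc, Units.mul_inv_cancel_left]
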